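/- Let m, n, p be positive integers with p dividing m. For every integer d with 0 ≤ d < ⌈(n−1)/2⌉, one has APS_d(m, p, n) = APS_d(m, n); that is, every admissible pinnacle set of Z_m ≀ S_n of cardinality at most d admits a witness lying in the complex reflection group G(m,p,n). -/

import Mathlib

open Finset

/-- `Prec p q` means the colored symbol `p = ξ^{p.1}(p.2)` precedes (is smaller than)
`q = ξ^{q.1}(q.2)`: `a > b`, or (`a = b` and `x > y`). -/
def Prec (p q : ℕ × ℕ) : Prop :=
  q.1 < p.1 ∨ (p.1 = q.1 ∧ q.2 < p.2)

instance : DecidableRel Prec := fun p q => by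
  unfold Prec; infer_instance

/-- `w : ℕ → ℕ × ℕ` (read on positions `1,…,n`) is an element of `Z_m ≀ S_n`:
each entry has color `< m` and norm in `{1,…,n}`, and the norms are pairwise distinct. -/
def IsGenPerm (m n : ℕ) (w : ℕ → ℕ × ℕ) : Prop :=
  (∀ i ∈ Finset.Icc 1 n, (w i).1 < m ∧ (w i).2 ∈ Finset.Icc 1 n) ∧
    Set.InjOn (fun i => (w i).2) (Set.Icc 1 n)

/-- The pinnacle set of the word `w`: values at interior positions `2 ≤ i ≤ n-1`
that strictly dominate both neighbors. -/
def pin (n : ℕ) (w : ℕ → ℕ × ℕ) : Finset (ℕ × ℕ) :=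
  ((Finset.Icc 2 (n - 1)).filter
      (fun i => Prec (w (i - 1)) (w i) ∧ Prec (w (i + 1)) (w i))).image w

/-- `P` is an admissible pinnacle set for `Z_m ≀ S_n`. -/
def IsAdmissible (m n : ℕ) (P : Finset (ℕ × ℕ)) : Prop :=
  ∃ w, IsGenPerm m n w ∧ pin n w = P

/-- `APS m n d` : admissible pinnacle sets for `Z_m ≀ S_n` of cardinality at most `d`. -/
def APS (m n d : ℕ) : Set (Finset (ℕ × ℕ)) :=
  {P | IsAdmissible m n P ∧ P.card ≤ d}

/-- The color sum `ε_w = e_1 + ⋯ + e_n` of a word `w`. -/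
def epsSum (n : ℕ) (w : ℕ → ℕ × ℕ) : ℕ :=
  ∑ i ∈ Finset.Icc 1 n, (w i).1

/-- `APSc m p n d` : sets `P` with `#P ≤ d` admitting a witness in the complex
reflection group `G(m,p,n) = {w ∈ Z_m ≀ S_n : ε_w ≡ 0 (mod p)}`. -/
def APSc (m p n d : ℕ) : Set (Finset (ℕ × ℕ)) :=
  {P | (∃ w, IsGenPerm m n w ∧ p ∣ epsSum n w ∧ pin n w = P) ∧ P.card ≤ d}

theorem Prec.trans {a b c : ℕ × ℕ} (hab : Prec a b) (hbc : Prec b c) : Prec a c := by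
  unfold Prec at *; omega

theorem Prec.asymm {a b : ℕ × ℕ} (hab : Prec a b) : ¬ Prec b a := by
  unfold Prec at *; omega

theorem Prec.not_trans {a b c : ℕ × ℕ} (hba : ¬ Prec b a) (hbc : Prec b c) : Prec a c := by
  unfold Prec at *; omega

/-- The list of interior entries of a word that strictly dominate both neighbors. -/
def peaks : List (ℕ × ℕ) → List (ℕ × ℕ)
  | a :: b :: c :: l =>
    if Prec a b ∧ Prec c b then b :: peaks (b :: c :: l) else peaks (b :: c :: l)
  | _ => []

theorem peaks_sublist : ∀ l : List (ℕ × ℕ), (peaks l).Sublist l.tail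
  | [] => by simp [peaks]
  | [a] => by simp [peaks]
  | [a, b] => by simp [peaks]
  | a :: b :: c :: l => by
    have ih := peaks_sublist (b :: c :: l)
    rw [peaks]
    split_ifs
    · exact ih.cons_cons b
    · exact ih.cons b

theorem mem_peaks {x : ℕ × ℕ} : ∀ {l : List (ℕ × ℕ)}, x ∈ peaks l ↔
    ∃ i, i + 2 < l.length ∧ Prec (l.getD i (0, 0)) (l.getD (i + 1) (0, 0)) ∧
      Prec (l.getD (i + 2) (0, 0)) (l.getD (i + 1) (0, 0)) ∧ l.getD (i + 1) (0, 0) = x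
  | [] => by simp [peaks]
  | [a] => by simp [peaks]
  | [a, b] => by simp [peaks]
  | a :: b :: c :: l => by
    have ih := mem_peaks (x := x) (l := b :: c :: l)
    rw [← Nat.or_exists_add_one]
    simp only [List.length_cons, List.getD_cons_succ, List.getD_cons_zero, Nat.zero_add,
      Nat.add_lt_add_iff_right] at ih ⊢
    rw [peaks]
    split_ifs with h
    · rw [List.mem_cons, ih]
      refine or_congr ⟨fun e => ⟨by omega, h.1, h.2, e.symm⟩, fun e => e.2.2.2.symm⟩ ?_
      rfl
    · rw [ih]
      exact ⟨Or.inr, fun e => e.resolve_left fun e => h ⟨e.2.1, e.2.2.1⟩⟩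

/-- Inserting an entry that does not precede the first one, without changing the peaks. -/
theorem exists_insert_tail (z : ℕ × ℕ) : ∀ (a : ℕ × ℕ) (l : List (ℕ × ℕ)), ¬ Prec z a →
    ∃ b t, (b :: t).Perm (z :: l) ∧ peaks (a :: b :: t) = peaks (a :: l) ∧
      (b = z ∨ l.head? = some b) ∧ ∀ y, peaks (y :: a :: b :: t) = peaks (y :: a :: l)
  | a, [], h => ⟨z, [], List.Perm.refl _, by simp [peaks], by simp, by simp [peaks, h]⟩
  | a, b :: l, h => by
    by_cases hz : Prec z b
    · have hab : Prec a b := Prec.not_trans h hz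
      have key : peaks (a :: z :: b :: l) = peaks (a :: b :: l) := by
        cases l with
        | nil => simp [peaks, hz.asymm]
        | cons c l => simp [peaks, hz, hz.asymm, hab]
      refine ⟨z, b :: l, List.Perm.refl _, key, by simp, fun y => ?_⟩
      rw [peaks, key, peaks]
      simp [h, hab.asymm]
    · obtain ⟨c, t, hp, he, hc, hy⟩ := exists_insert_tail z b l hz
      have key := hy a
      refine ⟨b, c :: t, (hp.cons b).trans (List.Perm.swap z b l), key, by simp, fun y => ?_⟩
      rw [peaks, key, peaks]

/-- Any entry can be inserted into a word that does not start with a descent, without changing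
the peaks and without creating an initial descent. -/
theorem exists_insert (z a : ℕ × ℕ) (l : List (ℕ × ℕ)) (hl : ∀ x ∈ l.head?, ¬ Prec x a) :
    ∃ b t, (b :: t).Perm (z :: a :: l) ∧ peaks (b :: t) = peaks (a :: l) ∧
      ∀ x ∈ t.head?, ¬ Prec x b := by
  by_cases hz : Prec z a
  · refine ⟨z, a :: l, List.Perm.refl _, ?_, by simpa using hz.asymm⟩
    cases l with
    | nil => simp [peaks]
    | cons c l =>
      have : ¬ Prec c a := hl c (by simp)
      simp [peaks, this]
  · obtain ⟨b, t, hp, he, hb, -⟩ := exists_insert_tail z a l hz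
    refine ⟨a, b :: t, (hp.cons a).trans (List.Perm.swap z a l), he, ?_⟩
    rcases hb with rfl | hb
    · simpa using hz
    · simpa using hl b hb

theorem exists_insert_all : ∀ (R : List (ℕ × ℕ)) (a : ℕ × ℕ) (l : List (ℕ × ℕ)),
    (∀ x ∈ l.head?, ¬ Prec x a) → ∃ b t, (b :: t).Perm (R ++ a :: l) ∧
      peaks (b :: t) = peaks (a :: l) ∧ ∀ x ∈ t.head?, ¬ Prec x b
  | [], a, l, hl => ⟨a, l, List.Perm.refl _, rfl, hl⟩
  | z :: R, a, l, hl => by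
    obtain ⟨b, t, hp, he, hb⟩ := exists_insert_all R a l hl
    obtain ⟨c, s, hp', he', hc⟩ := exists_insert z b t hb
    exact ⟨c, s, hp'.trans (hp.cons z), he'.trans he, hc⟩

/-- Every nonempty word contains an alternating word of minimal length with the same peaks. -/
theorem exists_core : ∀ (a : ℕ × ℕ) (L : List (ℕ × ℕ)), ∃ v t R,
    (a :: L).Perm (R ++ v :: t) ∧ ¬ Prec a v ∧ (∀ x ∈ t.head?, Prec v x) ∧
      peaks (v :: t) = peaks (a :: L) ∧ t.length = 2 * (peaks (a :: L)).length
  | a, [] => ⟨a, [], [], List.Perm.refl _, fun h => h.asymm h, by simp, rfl, by simp [peaks]⟩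
  | a, [b] => by
    by_cases h : Prec a b
    · exact ⟨a, [], [b], List.Perm.swap b a [], fun h => h.asymm h, by simp, by simp [peaks],
        by simp [peaks]⟩
    · exact ⟨b, [], [a], List.Perm.refl _, h, by simp, by simp [peaks], by simp [peaks]⟩
  | a, b :: c :: M => by
    by_cases h : Prec a b ∧ Prec c b
    · obtain ⟨v, t, R, hp, hv, ht, he, hlen⟩ := exists_core c M
      have hvb : Prec v b := Prec.not_trans hv h.2
      have peel : ∀ (x : ℕ × ℕ) (s : List (ℕ × ℕ)), Prec x b →
          peaks (b :: x :: s) = peaks (x :: s) := by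
        intro x s hx
        cases s with
        | nil => simp [peaks]
        | cons y s => simp [peaks, hx.asymm]
      have hL : peaks (a :: b :: c :: M) = b :: peaks (c :: M) := by
        rw [peaks, if_pos h, peel c M h.2]
      refine ⟨a, b :: v :: t, R, ?_, fun h => h.asymm h, by simpa using h.1, ?_, ?_⟩
      · refine ((hp.cons b).cons a).trans ?_
        exact (((List.perm_middle (a := b) (l₁ := R) (l₂ := v :: t)).symm.cons a).trans
          (List.perm_middle (a := a) (l₁ := R) (l₂ := b :: v :: t)).symm)
      · rw [hL, peaks, if_pos ⟨h.1, hvb⟩, peel v t hvb, he]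
      · rw [hL]; simp [hlen]; omega
    · obtain ⟨v, t, R, hp, hv, ht, he, hlen⟩ := exists_core b (c :: M)
      have hL : peaks (a :: b :: c :: M) = peaks (b :: c :: M) := by rw [peaks, if_neg h]
      by_cases hav : Prec a v
      · refine ⟨a, t, v :: R, ?_, fun h => h.asymm h, fun x hx => hav.trans (ht x hx), ?_, ?_⟩
        · refine (hp.cons a).trans ?_
          have h1 : (R ++ v :: t).Perm (v :: R ++ t) := List.perm_middle
          exact (h1.cons a).trans List.perm_middle.symm
        · rw [hL, ← he]
          match t, ht with
          | [], _ => simp [peaks]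
          | [x], _ => simp [peaks]
          | x :: y :: t, ht =>
            have hvx : Prec v x := ht x (by simp)
            simp [peaks, hvx, hav.trans hvx]
        · rw [hL, hlen]
      · exact ⟨v, t, a :: R, hp.cons a, hav, ht, he.trans hL.symm, by rw [hL, hlen]⟩

/-- A word with few peaks can be rearranged, keeping its peaks, so that its first entry
can be replaced by anything without affecting the peaks. -/
theorem exists_free_head (L : List (ℕ × ℕ)) (hL : 2 * (peaks L).length + 2 ≤ L.length) :
    ∃ z u, L.Perm (z :: u) ∧ ∀ y, peaks (y :: u) = peaks L := by
  cases L with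
  | nil => simp at hL
  | cons a L =>
    obtain ⟨v, t, R, hp, -, ht, he, hlen⟩ := exists_core a L
    cases R with
    | nil =>
      have := hp.length_eq
      simp only [List.nil_append, List.length_cons] at this hL
      omega
    | cons z R =>
      obtain ⟨b, s, hp', he', hb⟩ := exists_insert_all R v t fun x hx => (ht x hx).asymm
      refine ⟨z, b :: s, hp.trans (hp'.symm.cons z), fun y => ?_⟩
      rw [← he, ← he']
      cases s with
      | nil => simp [peaks]
      | cons c s =>
        have : ¬ Prec c b := hb c (by simp)
        simp [peaks, this]

/-- The word, indexed from `1`, with the given list of entries. -/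
def wordOf (l : List (ℕ × ℕ)) (i : ℕ) : ℕ × ℕ := l.getD (i - 1) (0, 0)

theorem pin_congr {n : ℕ} {w w' : ℕ → ℕ × ℕ} (h : ∀ i ∈ Finset.Icc 1 n, w i = w' i) :
    pin n w = pin n w' := by
  have h' : ∀ i, 1 ≤ i → i ≤ n → w i = w' i := fun i h1 h2 => h i (Finset.mem_Icc.2 ⟨h1, h2⟩)
  ext x
  simp only [pin, Finset.mem_image, Finset.mem_filter, Finset.mem_Icc]
  refine exists_congr fun i => ?_
  simp only [and_assoc]
  refine and_congr_right fun hi₁ => and_congr_right fun hi₂ => ?_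
  rw [h' (i - 1) (by omega) (by omega), h' i (by omega) (by omega),
    h' (i + 1) (by omega) (by omega)]

theorem pin_wordOf (l : List (ℕ × ℕ)) : pin l.length (wordOf l) = (peaks l).toFinset := by
  ext x
  simp only [pin, Finset.mem_image, Finset.mem_filter, Finset.mem_Icc, List.mem_toFinset,
    mem_peaks]
  simp only [wordOf]
  constructor
  · rintro ⟨i, ⟨⟨h1, h2⟩, h3, h4⟩, h5⟩
    obtain ⟨j, rfl⟩ := Nat.exists_eq_add_of_le' h1
    exact ⟨j, by omega, h3, h4, h5⟩
  · rintro ⟨j, h1, h2, h3, h4⟩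
    exact ⟨j + 2, ⟨⟨by omega, by omega⟩, h2, h3⟩, h4⟩

theorem epsSum_wordOf (l : List (ℕ × ℕ)) :
    epsSum l.length (wordOf l) = (l.map Prod.fst).sum := by
  induction l with
  | nil => simp [epsSum]
  | cons a l ih =>
    rw [List.map_cons, List.sum_cons, ← ih]
    simp only [epsSum, wordOf, ← Finset.Ico_add_one_right_eq_Icc, Finset.sum_Ico_eq_sum_range,
      List.length_cons, Nat.add_sub_cancel, Nat.add_sub_cancel_left]
    rw [Finset.sum_range_succ']
    simp [add_comm]

theorem isGenPerm_wordOf {m : ℕ} {l : List (ℕ × ℕ)} : IsGenPerm m l.length (wordOf l) ↔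
    (∀ x ∈ l, x.1 < m) ∧ (∀ x ∈ l.map Prod.snd, x ∈ Finset.Icc 1 l.length) ∧
      (l.map Prod.snd).Nodup := by
  have hget : ∀ i (h : i < l.length), wordOf l (i + 1) = l[i] := by
    intro i h; simp [wordOf, h]
  constructor
  · rintro ⟨h1, h2⟩
    refine ⟨?_, ?_, ?_⟩
    · intro x hx
      obtain ⟨i, hi, rfl⟩ := List.getElem_of_mem hx
      rw [← hget i hi]
      exact (h1 (i + 1) (Finset.mem_Icc.2 ⟨by omega, hi⟩)).1
    · intro y hy
      obtain ⟨x, hx, rfl⟩ := List.mem_map.1 hy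
      obtain ⟨i, hi, rfl⟩ := List.getElem_of_mem hx
      rw [← hget i hi]
      exact (h1 (i + 1) (Finset.mem_Icc.2 ⟨by omega, hi⟩)).2
    · rw [List.nodup_iff_injective_getElem]
      rintro ⟨i, hi⟩ ⟨j, hj⟩ hij
      simp only [List.length_map] at hi hj
      have := @h2 (i + 1) ⟨by omega, hi⟩ (j + 1) ⟨by omega, hj⟩
        (by simpa [hget i hi, hget j hj] using hij)
      simpa using this
  · rintro ⟨h1, h2, h3⟩
    refine ⟨?_, ?_⟩
    · intro i hi
      obtain ⟨hi1, hi2⟩ := Finset.mem_Icc.1 hi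
      obtain ⟨j, rfl⟩ := Nat.exists_eq_add_of_le' hi1
      rw [hget j hi2]
      exact ⟨h1 _ (List.getElem_mem _), h2 _ (List.mem_map_of_mem (List.getElem_mem _))⟩
    · rintro i ⟨hi1, hi2⟩ j ⟨hj1, hj2⟩ hij
      obtain ⟨i, rfl⟩ := Nat.exists_eq_add_of_le' hi1
      obtain ⟨j, rfl⟩ := Nat.exists_eq_add_of_le' hj1
      have : (l.map Prod.snd)[i]'(by simpa using hi2) = (l.map Prod.snd)[j]'(by simpa using hj2) := by
        simpa [hget i hi2, hget j hj2] using hij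
      rw [h3.getElem_inj_iff] at this
      rw [this]

theorem IsGenPerm.congr {m n : ℕ} {w w' : ℕ → ℕ × ℕ} (hw : IsGenPerm m n w)
    (h : ∀ i ∈ Finset.Icc 1 n, w i = w' i) : IsGenPerm m n w' := by
  refine ⟨fun i hi => h i hi ▸ hw.1 i hi, hw.2.congr fun i hi => ?_⟩
  simp only [h i (Finset.mem_Icc.2 hi)]

theorem exists_lt_dvd_add {p : ℕ} (hp : 1 ≤ p) (s : ℕ) : ∃ c < p, p ∣ c + s := by
  refine ⟨(p - s % p) % p, Nat.mod_lt _ hp, ?_⟩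
  rw [Nat.dvd_iff_mod_eq_zero, Nat.mod_add_mod, ← Nat.add_mod_mod,
    Nat.sub_add_cancel (Nat.mod_lt s hp).le, Nat.mod_self]

/-- For `d < ⌈(n-1)/2⌉` (which equals `n/2` for `n ≥ 1`), `APS_d(m,p,n) = APS_d(m,n)`. -/
theorem APSc_eq_APS_small (m p n d : ℕ) (hm : 1 ≤ m) (hp : 1 ≤ p) (hn : 1 ≤ n)
    (hpm : p ∣ m) (hd : d < n / 2) :
    APSc m p n d = APS m n d := by
  ext P
  constructor
  · rintro ⟨⟨w, hw, -, hP⟩, hcard⟩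
    exact ⟨⟨w, hw, hP⟩, hcard⟩
  rintro ⟨⟨w, hw, hP⟩, hcard⟩
  refine ⟨?_, hcard⟩
  obtain ⟨L, hlen, hLw⟩ : ∃ L : List (ℕ × ℕ), L.length = n ∧
      ∀ i ∈ Finset.Icc 1 n, w i = wordOf L i := by
    refine ⟨(List.range n).map fun i => w (i + 1), by simp, fun i hi => ?_⟩
    obtain ⟨hi1, hi2⟩ := Finset.mem_Icc.1 hi
    obtain ⟨j, rfl⟩ := Nat.exists_eq_add_of_le' hi1
    have : j < n := hi2
    simp [wordOf, this]
  subst hlen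
  rw [pin_congr hLw, pin_wordOf] at hP
  obtain ⟨hcol, hnorm, hnodup⟩ := isGenPerm_wordOf.1 (hw.congr hLw)
  have hpeaks : (peaks L).Nodup :=
    ((peaks_sublist L).trans (List.tail_sublist L)).nodup hnodup.of_map
  rw [← hP, List.toFinset_card_of_nodup hpeaks] at hcard
  obtain ⟨z, u, hperm, hfree⟩ := exists_free_head L (by omega)
  obtain ⟨c, hc, hdvd⟩ := exists_lt_dvd_add hp (u.map Prod.fst).sum
  have hlen : L.length = ((c, z.2) :: u).length := hperm.length_eq
  have hsnd : (L.map Prod.snd).Perm (((c, z.2) :: u).map Prod.snd) := hperm.map Prod.snd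
  refine ⟨wordOf ((c, z.2) :: u), ?_, ?_, ?_⟩
  · rw [hlen, isGenPerm_wordOf, ← hlen]
    refine ⟨fun x hx => ?_, fun x hx => hnorm x (hsnd.mem_iff.2 hx), hsnd.nodup hnodup⟩
    rcases List.mem_cons.1 hx with rfl | hx
    · exact hc.trans_le (Nat.le_of_dvd hm hpm)
    · exact hcol x (hperm.mem_iff.2 (List.mem_cons_of_mem z hx))
  · rw [hlen, epsSum_wordOf]
    simpa using hdvd
  · rw [hlen, pin_wordOf, hfree, hP]
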